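/- arXiv:1712.01194 — 5 statements merged into one kernel-verified Lean document; each statement's English description precedes it below -/
import Mathlib

section
/- Let X be a set and C ⊆ X × (ℕ → X) a collection of pairs of a point and a sequence, satisfying the uniqueness hypothesis and admitting, for every x ∈ X, functions μ_ε(x,·) satisfying conditions (a), (b), (c). Then for every x ∈ X and every sequence (xₙ)ₙ in X, the sequence (xₙ)ₙ converges to x in the topology 𝒰(C) if and only if (x,(xₙ)ₙ) ∈ C. -/
open Filter Topology

/-- The topology `𝒰(C)` associated to a collection `C` of (point, sequence) pairs:
a set `U` is open iff for every `(x₀, (xₙ)) ∈ C` with `x₀ ∈ U`, the sequence `xₙ`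
is eventually in `U`. -/
def seqTopology {X : Type*} (C : Set (X × (ℕ → X))) : TopologicalSpace X where
  IsOpen U := ∀ p ∈ C, p.1 ∈ U → ∀ᶠ n in Filter.atTop, p.2 n ∈ U
  isOpen_univ := fun _ _ _ => Filter.Eventually.of_forall fun _ => trivial
  isOpen_inter := fun _ _ hU hV p hp hx =>
    (hU p hp hx.1).and (hV p hp hx.2)
  isOpen_sUnion := fun S hS p hp hx => by
    obtain ⟨U, hUS, hxU⟩ := hx
    exact (hS U hUS p hp hxU).mono fun n hn => ⟨U, hUS, hn⟩

theorem stmt0 {X : Type*} (C : Set (X × (ℕ → X)))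
    (huniq : ∀ x₀ y₀ : X, ∀ xs : ℕ → X, (x₀, xs) ∈ C → (y₀, xs) ∈ C → x₀ = y₀)
    (ε₀ : X → ℝ) (hε₀ : ∀ x, 0 < ε₀ x)
    (μ : X → ℝ → X → ENNReal)
    (ha : ∀ x : X, ∀ ε : ℝ, 0 < ε → ε < ε₀ x → μ x ε x = 0)
    (hb : ∀ x : X, ∀ ε : ℝ, 0 < ε → ε < ε₀ x → ∀ xs : ℕ → X,
      ((x, xs) ∈ C ↔ Filter.Tendsto (fun n => μ x ε (xs n)) Filter.atTop (nhds 0)))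
    (hc : ∀ x : X, ∀ ε : ℝ, 0 < ε → ε < ε₀ x → ∀ x' : X, ∀ xs : ℕ → X,
      (x', xs) ∈ C → μ x ε x' < ENNReal.ofReal ε →
      Filter.limsup (fun n => μ x ε (xs n)) Filter.atTop ≤ μ x ε x') :
    ∀ x : X, ∀ xs : ℕ → X,
      Filter.Tendsto xs Filter.atTop (@nhds X (seqTopology C) x) ↔ (x, xs) ∈ C := by
  intro x xs
  let _ : TopologicalSpace X := seqTopology C
  constructor
  · intro h
    obtain ⟨ε, hε, hεx⟩ := exists_between (hε₀ x)
    rw [hb x ε hε hεx xs, ENNReal.tendsto_nhds_zero]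
    intro δ hδ
    have hopen : IsOpen {y | μ x ε y < min δ (ENNReal.ofReal ε)} := by
      rintro ⟨x', ys⟩ hp hx'
      exact eventually_lt_of_limsup_lt
        ((hc x ε hε hεx x' ys hp (lt_of_lt_of_le hx' (min_le_right _ _))).trans_lt hx')
    have hmem : x ∈ {y | μ x ε y < min δ (ENNReal.ofReal ε)} := by
      simpa [ha x ε hε hεx] using ⟨hδ, hε⟩
    filter_upwards [h.eventually (hopen.mem_nhds hmem)] with n hn
    exact (lt_of_lt_of_le hn (min_le_left _ _)).le
  · intro h
    exact tendsto_nhds.2 fun U hU hx => hU (x, xs) h hx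
end

section
/- Let X be a set and C ⊆ X × (ℕ → X) a collection of pairs of a point and a sequence, satisfying the uniqueness hypothesis and admitting, for every x ∈ X, functions μ_ε(x,·) satisfying conditions (a), (b), (c). Then the topological space (X, 𝒰(C)) is first countable: every point of X has a countable neighborhood basis in the topology 𝒰(C). -/
open Filter Topology

theorem stmt1 {X : Type*} (C : Set (X × (ℕ → X)))
    (huniq : ∀ x₀ y₀ : X, ∀ xs : ℕ → X, (x₀, xs) ∈ C → (y₀, xs) ∈ C → x₀ = y₀)
    (ε₀ : X → ℝ) (hε₀ : ∀ x, 0 < ε₀ x)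
    (μ : X → ℝ → X → ENNReal)
    (ha : ∀ x : X, ∀ ε : ℝ, 0 < ε → ε < ε₀ x → μ x ε x = 0)
    (hb : ∀ x : X, ∀ ε : ℝ, 0 < ε → ε < ε₀ x → ∀ xs : ℕ → X,
      ((x, xs) ∈ C ↔ Filter.Tendsto (fun n => μ x ε (xs n)) Filter.atTop (nhds 0)))
    (hc : ∀ x : X, ∀ ε : ℝ, 0 < ε → ε < ε₀ x → ∀ x' : X, ∀ xs : ℕ → X,
      (x', xs) ∈ C → μ x ε x' < ENNReal.ofReal ε →
      Filter.limsup (fun n => μ x ε (xs n)) Filter.atTop ≤ μ x ε x') :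
    @FirstCountableTopology X (seqTopology C) := by
  let _ : TopologicalSpace X := seqTopology C
  refine ⟨fun x => ?_⟩
  obtain ⟨ε, hε, hεx⟩ := exists_between (hε₀ x)
  suffices h : 𝓝 x = comap (μ x ε) (𝓝 0) by
    rw [h]
    infer_instance
  apply le_antisymm
  · rw [← tendsto_iff_comap, ENNReal.nhds_zero_basis.tendsto_right_iff]
    intro δ hδ
    have hopen : IsOpen {y | μ x ε y < min δ (ENNReal.ofReal ε)} := by
      rintro ⟨x', xs⟩ hp (hx' : μ x ε x' < _)
      exact eventually_lt_of_limsup_lt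
        ((hc x ε hε hεx x' xs hp (hx'.trans_le (min_le_right _ _))).trans_lt hx')
    have hx : x ∈ {y | μ x ε y < min δ (ENNReal.ofReal ε)} := by
      simp [ha x ε hε hεx, hδ, hε]
    filter_upwards [hopen.mem_nhds hx] with y hy
    exact lt_of_lt_of_le hy (min_le_left _ _)
  · refine tendsto_id'.mp (tendsto_of_seq_tendsto fun u hu => ?_)
    have hu' : (x, u) ∈ C := (hb x ε hε hεx u).mpr (tendsto_comap_iff.mp hu)
    rw [tendsto_nhds]
    exact fun U hU hxU => hU (x, u) hu' hxU
end

section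
/- Let X be a set and C ⊆ X × (ℕ → X) a collection of pairs of a point and a sequence, satisfying the uniqueness hypothesis and admitting, for every x ∈ X, functions μ_ε(x,·) satisfying conditions (a), (b), (c). Then the topological space (X, 𝒰(C)) is Hausdorff. -/
open Filter Topology

theorem isOpen_seqTopology_sublevel {X : Type*} {C : Set (X × (ℕ → X))} {f : X → ENNReal}
    {r δ : ENNReal} (hδ : δ ≤ r)
    (hf : ∀ x' : X, ∀ xs : ℕ → X, (x', xs) ∈ C → f x' < r →
      limsup (fun n => f (xs n)) atTop ≤ f x') :
    IsOpen[seqTopology C] {z | f z < δ} :=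
  fun p hp hpδ => eventually_lt_of_limsup_lt
    ((hf p.1 p.2 hp (lt_of_lt_of_le hpδ hδ)).trans_lt hpδ)

theorem stmt2 {X : Type*} (C : Set (X × (ℕ → X)))
    (huniq : ∀ x₀ y₀ : X, ∀ xs : ℕ → X, (x₀, xs) ∈ C → (y₀, xs) ∈ C → x₀ = y₀)
    (ε₀ : X → ℝ) (hε₀ : ∀ x, 0 < ε₀ x)
    (μ : X → ℝ → X → ENNReal)
    (ha : ∀ x : X, ∀ ε : ℝ, 0 < ε → ε < ε₀ x → μ x ε x = 0)
    (hb : ∀ x : X, ∀ ε : ℝ, 0 < ε → ε < ε₀ x → ∀ xs : ℕ → X,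
      ((x, xs) ∈ C ↔ Filter.Tendsto (fun n => μ x ε (xs n)) Filter.atTop (nhds 0)))
    (hc : ∀ x : X, ∀ ε : ℝ, 0 < ε → ε < ε₀ x → ∀ x' : X, ∀ xs : ℕ → X,
      (x', xs) ∈ C → μ x ε x' < ENNReal.ofReal ε →
      Filter.limsup (fun n => μ x ε (xs n)) Filter.atTop ≤ μ x ε x') :
    @T2Space X (seqTopology C) := by
  have half_pos' (x : X) : 0 < ε₀ x / 2 := half_pos (hε₀ x)
  have half_lt (x : X) : ε₀ x / 2 < ε₀ x := half_lt_self (hε₀ x)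
  let f : X → X → ENNReal := fun x => μ x (ε₀ x / 2)
  let r : X → ENNReal := fun x => ENNReal.ofReal (ε₀ x / 2)
  have hr (x : X) : 0 < r x := ENNReal.ofReal_pos.2 (half_pos' x)
  let U : X → ℕ → Set X := fun x n => {z | f x z < min (r x) ((n : ENNReal) + 1)⁻¹}
  have hU (x : X) (n : ℕ) : IsOpen[seqTopology C] (U x n) :=
    isOpen_seqTopology_sublevel (min_le_left _ _) (hc x _ (half_pos' x) (half_lt x))
  have hxU (x : X) (n : ℕ) : x ∈ U x n := by
    change μ x (ε₀ x / 2) x < _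
    rw [ha x _ (half_pos' x) (half_lt x)]
    exact lt_min (hr x) (ENNReal.inv_pos.2 (by finiteness))
  have hC (x : X) (z : ℕ → X) (hz : ∀ n, z n ∈ U x n) : (x, z) ∈ C := by
    refine (hb x _ (half_pos' x) (half_lt x) z).2 ?_
    have hlim : Tendsto (fun n : ℕ => ((n : ENNReal) + 1)⁻¹) atTop (𝓝 0) := by
      simpa using (tendsto_add_atTop_iff_nat 1).2 ENNReal.tendsto_inv_nat_nhds_zero
    exact tendsto_of_tendsto_of_tendsto_of_le_of_le tendsto_const_nhds hlim
      (fun _ => zero_le) fun n => ((hz n).trans_le (min_le_right _ _)).le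
  letI := seqTopology C
  refine ⟨fun x y hxy => ?_⟩
  by_contra hsep
  have hmeet (n : ℕ) : ∃ z, z ∈ U x n ∧ z ∈ U y n := by
    by_contra hdisj
    exact hsep ⟨U x n, U y n, hU x n, hU y n, hxU x n, hxU y n,
      Set.disjoint_left.2 fun z hzx hzy => hdisj ⟨z, hzx, hzy⟩⟩
  choose z hzx hzy using hmeet
  exact hxy (huniq x y z (hC x z hzx) (hC y z hzy))
end

section
/- Let (a_ν)_ν ⊆ ℝ_{>0} and (b_ν)_ν ⊆ ℝ², and let τ_ν : ℝ² ∪ {∞} → ℝ² ∪ {∞} be the extension of z ↦ a_ν·z + b_ν fixing ∞. If no subsequence of ((a_ν, b_ν))_ν converges to a pair (a,b) with a ∈ ℝ_{>0} and b ∈ ℝ² (i.e., (τ_ν) has no subsequence converging uniformly to an element of G₂), then there exist a subsequence (τ_{ν_j})_j and points w, w' ∈ ℝ² ∪ {∞} such that (τ_{ν_j})_j converges to w uniformly on compact subsets away from w'. -/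
open Filter Topology OnePoint

/-- The extension to the one-point compactification `ℝ² ∪ {∞}` of the affine map
`z ↦ a • z + b` (an element of the reparametrization group `G₂` when `0 < a`),
fixing the point at infinity. -/
noncomputable def affExt (a : ℝ) (b : ℝ × ℝ) : OnePoint (ℝ × ℝ) → OnePoint (ℝ × ℝ)
  | ∞ => ∞
  | (z : ℝ × ℝ) => ((a • z + b : ℝ × ℝ) : OnePoint (ℝ × ℝ))

/-- A sequence of maps `τ_ν : ℝ² ∪ {∞} → ℝ² ∪ {∞}` converges to `w` uniformly on
compact subsets away from `w'` if for every compact `K ⊆ (ℝ² ∪ {∞}) \ {w'}` and every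
neighborhood `V` of `w`, eventually `τ_ν(K) ⊆ V`. -/
def TendstoUCSAway (τ : ℕ → OnePoint (ℝ × ℝ) → OnePoint (ℝ × ℝ))
    (w w' : OnePoint (ℝ × ℝ)) : Prop :=
  ∀ K : Set (OnePoint (ℝ × ℝ)), IsCompact K → K ⊆ {w'}ᶜ →
    ∀ V ∈ nhds w, ∀ᶠ ν in Filter.atTop, ∀ z ∈ K, τ ν z ∈ V

/-- In a proper normed space every sequence has a subsequence that either converges or escapes to
infinity. -/
theorem exists_subseq_tendsto_or_norm_atTop {E : Type*} [NormedAddCommGroup E] [ProperSpace E]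
    (u : ℕ → E) : ∃ φ : ℕ → ℕ, StrictMono φ ∧
      ((∃ x, Tendsto (fun j => u (φ j)) atTop (𝓝 x)) ∨
        Tendsto (fun j => ‖u (φ j)‖) atTop atTop) := by
  by_cases h : Tendsto (fun j => ‖u j‖) atTop atTop
  · exact ⟨id, strictMono_id, Or.inr h⟩
  · simp only [tendsto_atTop, not_forall] at h
    obtain ⟨C, hC⟩ := h
    have hfreq : ∃ᶠ j in atTop, u j ∈ Metric.closedBall (0 : E) C := by
      refine (not_eventually.1 hC).mono fun j hj => ?_
      simpa using (not_le.1 hj).le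
    obtain ⟨x, -, φ, hφ, hx⟩ := tendsto_subseq_of_frequently_bounded Metric.isBounded_closedBall hfreq
    exact ⟨φ, hφ, Or.inl ⟨x, hx⟩⟩

theorem tendsto_norm_add_atTop {ι E : Type*} [SeminormedAddCommGroup E] {l : Filter ι}
    {f g : ι → E} {c : E} (hf : Tendsto f l (𝓝 c)) (hg : Tendsto (fun i => ‖g i‖) l atTop) :
    Tendsto (fun i => ‖f i + g i‖) l atTop := by
  refine tendsto_atTop_mono (fun i => ?_) (hf.norm.neg.add_atTop hg)
  have := norm_sub_norm_le (g i) (-f i)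
  rw [norm_neg, sub_neg_eq_add, add_comm (g i)] at this
  linarith

theorem tendsto_coe_infty_of_norm_atTop {ι E : Type*} [NormedAddCommGroup E] [ProperSpace E]
    {l : Filter ι} {f : ι → E} (hf : Tendsto (fun i => ‖f i‖) l atTop) :
    Tendsto (fun i => (f i : OnePoint E)) l (𝓝 ∞) := by
  rw [tendsto_norm_atTop_iff_cobounded, Metric.cobounded_eq_cocompact,
    ← coclosedCompact_eq_cocompact] at hf
  exact tendsto_coe_infty.comp hf

/-- Locally uniform convergence at each point other than `w'` implies uniform convergence on
compact subsets away from `w'`. -/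
theorem tendstoUCSAway_of_tendsto_prod_nhds {τ : ℕ → OnePoint (ℝ × ℝ) → OnePoint (ℝ × ℝ)}
    {w w' : OnePoint (ℝ × ℝ)}
    (h : ∀ z ≠ w', Tendsto (fun p : ℕ × OnePoint (ℝ × ℝ) => τ p.1 p.2) (atTop ×ˢ 𝓝 z) (𝓝 w)) :
    TendstoUCSAway τ w w' := by
  intro K hK hKw V hV
  refine hK.induction_on (p := fun s => ∀ᶠ ν in atTop, ∀ z ∈ s, τ ν z ∈ V) (by simp)
    (fun s t hst ht => ht.mono fun ν hν z hz => hν z (hst hz)) (fun s t hs ht => ?_)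
    fun z hz => ?_
  · filter_upwards [hs, ht] with ν h₁ h₂ z hz
    exact hz.elim (h₁ z) (h₂ z)
  · obtain ⟨P, hP, Q, hQ, hPQ⟩ := eventually_prod_iff.1 ((h z (hKw hz)).eventually hV)
    exact ⟨{y | Q y}, mem_nhdsWithin_of_mem_nhds hQ, hP.mono fun ν hν y hy => hPQ hν hy⟩

theorem tendsto_affExt_prod_nhds_coe {a : ℕ → ℝ} {b : ℕ → ℝ × ℝ} {z : ℝ × ℝ}
    {w : OnePoint (ℝ × ℝ)}
    (h : Tendsto (fun p : ℕ × (ℝ × ℝ) => ((a p.1 • p.2 + b p.1 : ℝ × ℝ) : OnePoint (ℝ × ℝ)))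
      (atTop ×ˢ 𝓝 z) (𝓝 w)) :
    Tendsto (fun p : ℕ × OnePoint (ℝ × ℝ) => affExt (a p.1) (b p.1) p.2)
      (atTop ×ˢ 𝓝 (z : OnePoint (ℝ × ℝ))) (𝓝 w) := by
  rw [nhds_coe_eq, ← map_id (f := (atTop : Filter ℕ)), prod_map_map_eq, tendsto_map'_iff]
  exact h

theorem tendsto_affExt_prod_nhds_infty {a : ℕ → ℝ} {b : ℕ → ℝ × ℝ}
    (h : Tendsto (fun p : ℕ × (ℝ × ℝ) => ‖a p.1 • p.2 + b p.1‖)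
      (atTop ×ˢ Bornology.cobounded (ℝ × ℝ)) atTop) :
    Tendsto (fun p : ℕ × OnePoint (ℝ × ℝ) => affExt (a p.1) (b p.1) p.2)
      (atTop ×ˢ 𝓝 (∞ : OnePoint (ℝ × ℝ))) (𝓝 ∞) := by
  rw [nhds_infty_eq, prod_sup, tendsto_sup, ← nhds_infty_eq]
  constructor
  · rw [← map_id (f := (atTop : Filter ℕ)), prod_map_map_eq, tendsto_map'_iff,
      coclosedCompact_eq_cocompact, ← Metric.cobounded_eq_cocompact]
    exact tendsto_coe_infty_of_norm_atTop h
  · rw [prod_pure, tendsto_map'_iff]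
    exact tendsto_const_nhds

theorem tendstoUCSAway_affExt_infty_of_norm_atTop {a : ℕ → ℝ} {b : ℕ → ℝ × ℝ} {A : ℝ}
    (ha : Tendsto a atTop (𝓝 A)) (hb : Tendsto (fun j => ‖b j‖) atTop atTop) :
    TendstoUCSAway (fun j => affExt (a j) (b j)) ∞ ∞ := by
  refine tendstoUCSAway_of_tendsto_prod_nhds fun z hz => ?_
  obtain ⟨z, rfl⟩ := ne_infty_iff_exists.1 hz
  exact tendsto_affExt_prod_nhds_coe <| tendsto_coe_infty_of_norm_atTop <|
    tendsto_norm_add_atTop ((ha.comp tendsto_fst).smul tendsto_snd) (hb.comp tendsto_fst)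

theorem tendstoUCSAway_affExt_coe {a : ℕ → ℝ} {b : ℕ → ℝ × ℝ} {B : ℝ × ℝ}
    (ha : Tendsto a atTop (𝓝 0)) (hb : Tendsto b atTop (𝓝 B)) :
    TendstoUCSAway (fun j => affExt (a j) (b j)) B ∞ := by
  refine tendstoUCSAway_of_tendsto_prod_nhds fun z hz => ?_
  obtain ⟨z, rfl⟩ := ne_infty_iff_exists.1 hz
  have h := ((ha.comp tendsto_fst).smul tendsto_snd).add
    (hb.comp (tendsto_fst (f := atTop) (g := 𝓝 z)))
  rw [zero_smul, zero_add] at h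
  exact tendsto_affExt_prod_nhds_coe ((continuous_coe.tendsto B).comp h)

theorem norm_smul_add_eq_mul_norm_add {a : ℝ} (ha : 0 < a) (z b : ℝ × ℝ) :
    ‖a • z + b‖ = a * ‖z + a⁻¹ • b‖ := by
  rw [← abs_of_pos ha, ← Real.norm_eq_abs, ← norm_smul, Real.norm_eq_abs, abs_of_pos ha, smul_add,
    smul_inv_smul₀ ha.ne']

theorem tendstoUCSAway_affExt_of_tendsto_inv_smul {a : ℕ → ℝ} {b : ℕ → ℝ × ℝ} {Q : ℝ × ℝ}
    (hpos : ∀ j, 0 < a j) (ha : Tendsto a atTop atTop)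
    (hQ : Tendsto (fun j => (a j)⁻¹ • b j) atTop (𝓝 Q)) :
    TendstoUCSAway (fun j => affExt (a j) (b j)) ∞ (-Q : ℝ × ℝ) := by
  refine tendstoUCSAway_of_tendsto_prod_nhds fun z hz => ?_
  induction z using OnePoint.rec with
  | infty =>
    refine tendsto_affExt_prod_nhds_infty ?_
    simp only [norm_smul_add_eq_mul_norm_add (hpos _)]
    simp only [add_comm _ ((a _)⁻¹ • b _)]
    exact (ha.comp tendsto_fst).atTop_mul_atTop₀ <|
      tendsto_norm_add_atTop (hQ.comp tendsto_fst) (tendsto_norm_cobounded_atTop.comp tendsto_snd)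
  | coe z =>
    refine tendsto_affExt_prod_nhds_coe <| tendsto_coe_infty_of_norm_atTop ?_
    simp only [norm_smul_add_eq_mul_norm_add (hpos _)]
    have hne : 0 < ‖z + Q‖ := norm_pos_iff.2 fun h => hz (by rw [eq_neg_of_add_eq_zero_left h])
    exact (ha.comp tendsto_fst).atTop_mul_pos hne
      (tendsto_snd.add (hQ.comp tendsto_fst)).norm

theorem tendstoUCSAway_affExt_of_norm_inv_smul_atTop {a : ℕ → ℝ} {b : ℕ → ℝ × ℝ}
    (hpos : ∀ j, 0 < a j) (ha : Tendsto a atTop atTop)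
    (hQ : Tendsto (fun j => ‖(a j)⁻¹ • b j‖) atTop atTop) :
    TendstoUCSAway (fun j => affExt (a j) (b j)) ∞ ∞ := by
  refine tendstoUCSAway_of_tendsto_prod_nhds fun z hz => ?_
  obtain ⟨z, rfl⟩ := ne_infty_iff_exists.1 hz
  refine tendsto_affExt_prod_nhds_coe <| tendsto_coe_infty_of_norm_atTop ?_
  simp only [norm_smul_add_eq_mul_norm_add (hpos _)]
  exact (ha.comp tendsto_fst).atTop_mul_atTop₀ <|
    tendsto_norm_add_atTop tendsto_snd (hQ.comp tendsto_fst)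

theorem stmt4 (a : ℕ → ℝ) (ha : ∀ ν, 0 < a ν) (b : ℕ → ℝ × ℝ)
    (hnoconv : ¬ ∃ φ : ℕ → ℕ, StrictMono φ ∧ ∃ (aLim : ℝ) (bLim : ℝ × ℝ), 0 < aLim ∧
      Filter.Tendsto (fun j => (a (φ j), b (φ j))) Filter.atTop (nhds (aLim, bLim))) :
    ∃ φ : ℕ → ℕ, StrictMono φ ∧ ∃ w w' : OnePoint (ℝ × ℝ),
      TendstoUCSAway (fun j => affExt (a (φ j)) (b (φ j))) w w' := by
  obtain ⟨φ, hφ, ⟨A, hA⟩ | hA⟩ := exists_subseq_tendsto_or_norm_atTop a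
  · obtain ⟨ψ, hψ, ⟨B, hB⟩ | hB⟩ := exists_subseq_tendsto_or_norm_atTop fun j => b (φ j)
    · have hA' := hA.comp hψ.tendsto_atTop
      obtain rfl | hApos := (ge_of_tendsto' hA fun j => (ha (φ j)).le).eq_or_lt
      · exact ⟨φ ∘ ψ, hφ.comp hψ, B, ∞, tendstoUCSAway_affExt_coe hA' hB⟩
      · exact absurd ⟨φ ∘ ψ, hφ.comp hψ, A, B, hApos, hA'.prodMk_nhds hB⟩ hnoconv
    · exact ⟨φ ∘ ψ, hφ.comp hψ, ∞, ∞,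
        tendstoUCSAway_affExt_infty_of_norm_atTop (hA.comp hψ.tendsto_atTop) hB⟩
  · simp only [Real.norm_of_nonneg (ha _).le] at hA
    obtain ⟨ψ, hψ, ⟨Q, hQ⟩ | hQ⟩ :=
      exists_subseq_tendsto_or_norm_atTop fun j => (a (φ j))⁻¹ • b (φ j)
    · exact ⟨φ ∘ ψ, hφ.comp hψ, ∞, (-Q : ℝ × ℝ), tendstoUCSAway_affExt_of_tendsto_inv_smul
        (fun _ => ha _) (hA.comp hψ.tendsto_atTop) hQ⟩
    · exact ⟨φ ∘ ψ, hφ.comp hψ, ∞, ∞, tendstoUCSAway_affExt_of_norm_inv_smul_atTop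
        (fun _ => ha _) (hA.comp hψ.tendsto_atTop) hQ⟩
end

section
/- Let (σ_ν)_ν and (τ_ν)_ν be sequences of maps ℝ² ∪ {∞} → ℝ² ∪ {∞} induced by elements of G₂ (extensions of z ↦ a·z + b with a ∈ ℝ_{>0}, b ∈ ℝ², fixing ∞). Suppose (σ_ν) converges to w₁ uniformly on compact subsets away from w₁', that (τ_ν) converges to w₂ uniformly on compact subsets away from w₂', and that w₂ ≠ w₁'. Then the composites (σ_ν ∘ τ_ν)_ν converge to w₁ uniformly on compact subsets away from w₂'. -/
open Filter Topology OnePoint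

theorem stmt7 (aσ aτ : ℕ → ℝ) (haσ : ∀ ν, 0 < aσ ν) (haτ : ∀ ν, 0 < aτ ν)
    (bσ bτ : ℕ → ℝ × ℝ) (w₁ w₁' w₂ w₂' : OnePoint (ℝ × ℝ))
    (hσ : TendstoUCSAway (fun ν => affExt (aσ ν) (bσ ν)) w₁ w₁')
    (hτ : TendstoUCSAway (fun ν => affExt (aτ ν) (bτ ν)) w₂ w₂')
    (hne : w₂ ≠ w₁') :
    TendstoUCSAway (fun ν => affExt (aσ ν) (bσ ν) ∘ affExt (aτ ν) (bτ ν)) w₁ w₂' := by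
  intro K hK hKw V hV
  obtain ⟨L, hL, hLw, hLc⟩ :=
    local_compact_nhds (isOpen_compl_singleton.mem_nhds (show w₂ ∈ ({w₁'}ᶜ : Set _) from hne))
  filter_upwards [hτ K hK hKw L hL, hσ L hLc hLw V hV] with ν hτν hσν z hz
  exact hσν _ (hτν z hz)
end
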